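/- Let E be a CM field of degree 2d over ℚ, X the set of embeddings E → ℚ̄ with its G_ℚ-action g·φ = g∘φ, and T the finite set of CM types of E with the induced G_ℚ-action g·Φ = {g∘φ : φ ∈ Φ}. For a group G acting on a finite set Y and a subset S ⊆ Y, define A_S : G → ℚ by A_S(g) = |S ∩ g·S|, and A⁰_S(g) = |G·S|^{−1} · Σ_{S' ∈ G·S} A_{S'}(g), the average over the (finite) G-orbit of S among subsets of Y. Fix an embedding ι₀ ∈ X and set Φ^♯ = {Φ ∈ T : ι₀ ∈ Φ} ⊆ T. Then for every g ∈ G_ℚ: A⁰_{Φ^♯}(g), computed for the G_ℚ-set T, equals (1/(2d)) · Σ_{Φ ∈ T} A⁰_Φ(g), computed for the G_ℚ-set X. (This is the combinatorial content of the identity A⁰_{(E^♯,Φ^♯)} = (1/2d)·Σ_Φ A⁰_{(E,Φ)} relating the total reflex pair to the CM types of E.) -/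

import Mathlib

open scoped Pointwise

/-- `ℚ̄`, the algebraic closure of `ℚ` in `ℂ`. -/
noncomputable abbrev Qbar : IntermediateField ℚ ℂ := algebraicClosure ℚ ℂ

/-- Complex conjugation, as a `ℚ`-algebra homomorphism `ℂ → ℂ`. -/
noncomputable def conjC : ℂ →ₐ[ℚ] ℂ :=
  ((Complex.conjAe.restrictScalars ℚ).toAlgHom)

/-- Complex conjugation restricted to `ℚ̄ ⊂ ℂ`. -/
noncomputable def qbarConj : Qbar →ₐ[ℚ] Qbar where
  toFun x := ⟨conjC x, mem_algebraicClosure_iff'.mpr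
    ((mem_algebraicClosure_iff'.mp x.2).map conjC)⟩
  map_one' := Subtype.ext (by simp)
  map_mul' x y := Subtype.ext (by simp)
  map_zero' := Subtype.ext (by simp)
  map_add' x y := Subtype.ext (by simp)
  commutes' q := Subtype.ext (by simp [IntermediateField.algebraMap_apply])

/-- The action of `G_ℚ = Gal(ℚ̄/ℚ)` on embeddings `E → ℚ̄`, by post-composition. -/
noncomputable instance algHomGaloisAction (E : Type*) [Field E] [Algebra ℚ E] :
    MulAction (Qbar ≃ₐ[ℚ] Qbar) (E →ₐ[ℚ] Qbar) where
  smul g φ := g.toAlgHom.comp φ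
  one_smul _ := AlgHom.ext fun _ => rfl
  mul_smul _ _ _ := AlgHom.ext fun _ => rfl

/-- `Φ` is a CM type of `E`: a set of embeddings `E → ℚ̄` such that `Φ` and its complex
conjugate `Φ̄` are disjoint with union the set of all embeddings. -/
def IsCMType (E : Type*) [Field E] [Algebra ℚ E] (Φ : Set (E →ₐ[ℚ] Qbar)) : Prop :=
  ∀ φ : E →ₐ[ℚ] Qbar, φ ∈ Φ ↔ qbarConj.comp φ ∉ Φ

/-- For a group `G` acting on a finite set `Y` and a subset `S ⊆ Y`, the averaged counting
function `A⁰_S(g) = |G·S|⁻¹ · Σ_{S' ∈ G·S} |S' ∩ g·S'|`, the average over the orbit of `S`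
of the functions `A_{S'}(g) = |S' ∩ g·S'|`. -/
noncomputable def A0 {G Y : Type*} [Group G] [MulAction G Y] [Finite Y]
    (S : Set Y) (g : G) : ℚ :=
  (Nat.card (MulAction.orbit G S) : ℚ)⁻¹ *
    ∑ S' ∈ (Set.toFinite (MulAction.orbit G S)).toFinset,
      (Nat.card ↥(S' ∩ g • S') : ℚ)

set_option linter.style.haveILetI false

theorem avg_orbit {G X Z : Type*} [Group G] [MulAction G X] [MulAction G Z] [Fintype X]
    [MulAction.IsPretransitive G X] (m : X → Z) (hm : ∀ (h : G) x, m (h • x) = h • m x)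
    (x0 : X) (hf : (MulAction.orbit G (m x0)).Finite) (f : Z → ℚ) :
    (Nat.card (MulAction.orbit G (m x0)) : ℚ)⁻¹ * ∑ z ∈ hf.toFinset, f z =
      (Nat.card X : ℚ)⁻¹ * ∑ x, f (m x) := by
  classical
  set c : ℕ := (Finset.univ.filter (fun x => m x = m x0)).card with hc
  have hmaps : ∀ x ∈ (Finset.univ : Finset X), m x ∈ hf.toFinset := by
    intro x _
    obtain ⟨h, rfl⟩ := MulAction.exists_smul_eq G x0 x
    rw [hm]
    simp [MulAction.mem_orbit]
  have hfib : ∀ z ∈ hf.toFinset, (Finset.univ.filter (fun x => m x = z)).card = c := by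
    intro z hz
    rw [Set.Finite.mem_toFinset] at hz
    obtain ⟨h, rfl⟩ := hz
    symm
    refine Finset.card_bij (fun x _ => h • x) ?_ ?_ ?_
    · intro x hx
      simp only [Finset.mem_filter, Finset.mem_univ, true_and] at hx ⊢
      rw [hm, hx]
    · intro a _ b _ hab
      exact smul_left_cancel h hab
    · intro b hb
      simp only [Finset.mem_filter, Finset.mem_univ, true_and] at hb
      refine ⟨h⁻¹ • b, ?_, by simp⟩
      simp [hm, hb]
  have key : ∀ f : Z → ℚ, ∑ x, f (m x) = c * ∑ z ∈ hf.toFinset, f z := by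
    intro f
    rw [← Finset.sum_fiberwise_of_maps_to hmaps, Finset.mul_sum]
    refine Finset.sum_congr rfl fun z hz => ?_
    rw [← hfib z hz, ← nsmul_eq_mul, ← Finset.sum_const]
    refine Finset.sum_congr rfl fun x hx => ?_
    rw [(Finset.mem_filter.1 hx).2]
  have h1 := key (fun _ => 1)
  simp only [Finset.sum_const, nsmul_eq_mul, mul_one, Finset.card_univ] at h1
  have hcard : Nat.card (MulAction.orbit G (m x0)) = hf.toFinset.card :=
    Nat.card_eq_card_finite_toFinset hf
  have hc0 : (c : ℚ) ≠ 0 := by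
    have : 0 < c := Finset.card_pos.2 ⟨x0, by simp⟩
    positivity
  rw [key f, Nat.card_eq_fintype_card (α := X), h1, hcard, mul_inv]
  field_simp

theorem sum_avg {G Z : Type*} [Group G] [MulAction G Z] (hZ : ∀ z : Z, (MulAction.orbit G z).Finite)
    (T : Finset Z) (hT : ∀ (h : G), ∀ z ∈ T, h • z ∈ T) (f : Z → ℚ) :
    ∑ z ∈ T, (Nat.card (MulAction.orbit G z) : ℚ)⁻¹ * ∑ w ∈ (hZ z).toFinset, f w =
      ∑ z ∈ T, f z := by
  classical
  simp_rw [Finset.mul_sum]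
  rw [Finset.sum_comm' (t' := T) (s' := fun w => (hZ w).toFinset)]
  · refine Finset.sum_congr rfl fun w _ => ?_
    have : ∀ z ∈ (hZ w).toFinset, (Nat.card (MulAction.orbit G z) : ℚ)⁻¹ * f w
        = (Nat.card (MulAction.orbit G w) : ℚ)⁻¹ * f w := by
      intro z hz
      rw [Set.Finite.mem_toFinset] at hz
      rw [MulAction.orbit_eq_iff.2 hz]
    rw [Finset.sum_congr rfl this, Finset.sum_const, nsmul_eq_mul,
      ← Nat.card_eq_card_finite_toFinset (hZ w), ← mul_assoc, mul_inv_cancel₀, one_mul]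
    rw [Nat.card_eq_card_finite_toFinset (hZ w), Nat.cast_ne_zero, Finset.card_ne_zero]
    exact ⟨w, by simp⟩
  · intro z w
    simp only [Set.Finite.mem_toFinset]
    constructor
    · rintro ⟨hz, h, rfl⟩
      exact ⟨MulAction.mem_orbit_symm.1 ⟨h, rfl⟩, hT h z hz⟩
    · rintro ⟨⟨h, rfl⟩, hw⟩
      exact ⟨hT h w hw, MulAction.mem_orbit_symm.1 ⟨h, rfl⟩⟩

theorem abstract_avg {G X : Type*} [Group G] [MulAction G X] [Finite X]
    [MulAction.IsPretransitive G X] (T : Set (Set X)) (hT : ∀ (h : G), ∀ Φ ∈ T, h • Φ ∈ T)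
    (x0 : X) (g : G) :
    A0 {Φ : Set X | Φ ∈ T ∧ x0 ∈ Φ} g =
      (Nat.card X : ℚ)⁻¹ * ∑ Φ ∈ (Set.toFinite T).toFinset, A0 Φ g := by
  classical
  have := Fintype.ofFinite X
  have hm : ∀ (h : G) (x : X), ({Φ : Set X | Φ ∈ T ∧ h • x ∈ Φ} : Set (Set X)) =
      h • {Φ : Set X | Φ ∈ T ∧ x ∈ Φ} := by
    intro h x
    ext Φ
    rw [Set.mem_smul_set_iff_inv_smul_mem]
    simp only [Set.mem_setOf_eq]
    rw [Set.mem_smul_set_iff_inv_smul_mem, inv_inv]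
    refine and_congr_left fun _ => ⟨hT _ _, fun hh => ?_⟩
    simpa using hT h _ hh
  unfold A0
  rw [avg_orbit (fun x => ({Φ : Set X | Φ ∈ T ∧ x ∈ Φ} : Set (Set X))) hm x0
    (Set.toFinite _) (fun S' => (Nat.card ↥(S' ∩ g • S') : ℚ))]
  rw [sum_avg (fun z => Set.toFinite _) (Set.toFinite T).toFinset (by simpa using hT)
    (fun S' => (Nat.card ↥(S' ∩ g • S') : ℚ))]
  congr 1
  have e1 : ∀ x : X, (Nat.card ↥({Φ : Set X | Φ ∈ T ∧ x ∈ Φ} ∩ g • {Φ : Set X | Φ ∈ T ∧ x ∈ Φ}) : ℚ)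
      = ∑ Φ ∈ (Set.toFinite T).toFinset, if x ∈ Φ ∧ g • x ∈ Φ then 1 else 0 := by
    intro x
    rw [Finset.sum_boole, ← hm, Nat.card_eq_card_finite_toFinset (Set.toFinite _)]
    congr 2
    ext Φ
    simp only [Set.Finite.mem_toFinset, Finset.mem_filter, Set.mem_inter_iff, Set.mem_setOf_eq]
    tauto
  have e2 : ∀ Φ : Set X, (Nat.card ↥(Φ ∩ g • Φ) : ℚ)
      = ∑ x : X, if x ∈ Φ ∧ g • x ∈ Φ then 1 else 0 := by
    intro Φ
    rw [Finset.sum_boole, Nat.card_eq_card_finite_toFinset (Set.toFinite _)]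
    congr 1
    symm
    refine Finset.card_bij (fun x _ => g • x) ?_ ?_ ?_
    · intro x hx
      simp only [Finset.mem_filter, Finset.mem_univ, true_and] at hx
      simp [hx.1, hx.2]
    · intro a _ b _ hab
      exact smul_left_cancel g hab
    · intro b hb
      simp only [Set.Finite.mem_toFinset, Set.mem_inter_iff,
        Set.mem_smul_set_iff_inv_smul_mem] at hb
      exact ⟨g⁻¹ • b, by simp [hb.1, hb.2], by simp⟩
  simp_rw [e1, e2]
  exact Finset.sum_comm

theorem qbar_closed : IsAlgClosed Qbar :=
  (algebraicClosure.isAlgClosure ℚ ℂ).isAlgClosed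

theorem qbar_alg : Algebra.IsAlgebraic ℚ Qbar := by
  have h := (algebraicClosure.isAlgClosure ℚ ℂ).isAlgebraic
  have e : (DivisionRing.toRatAlgebra : Algebra ℚ Qbar) = (algebraicClosure ℚ ℂ).algebra' :=
    Subsingleton.elim _ _
  rw [e]
  exact h

theorem exists_lift {E L : Type*} [Field E] [Algebra ℚ E] [Field L] [Algebra ℚ L] [IsAlgClosed L]
    [Algebra.IsAlgebraic ℚ L] (φ ψ : E →ₐ[ℚ] L) :
    ∃ τ : L →ₐ[ℚ] L, ∀ x, τ (φ x) = ψ x := by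
  letI : Algebra E L := φ.toRingHom.toAlgebra
  haveI : IsScalarTower ℚ E L := IsScalarTower.of_algebraMap_eq (fun x => (φ.commutes x).symm)
  haveI : Algebra.IsAlgebraic E L := Algebra.IsAlgebraic.tower_top (K := ℚ) E
  obtain ⟨τ, hτ⟩ := IsAlgClosed.surjective_domRestrict_of_isAlgebraic (K := ℚ) (L := E) (M := L) (E := L) ψ
  exact ⟨τ, fun x => DFunLike.congr_fun hτ x⟩

theorem pretrans_emb (E : Type*) [Field E] [NumberField E] :
    MulAction.IsPretransitive (Qbar ≃ₐ[ℚ] Qbar) (E →ₐ[ℚ] Qbar) := by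
  constructor
  intro φ ψ
  haveI hac : IsAlgClosed Qbar := qbar_closed
  haveI : Algebra.IsAlgebraic ℚ Qbar := qbar_alg
  obtain ⟨τ, hτ⟩ : ∃ τ : Qbar →ₐ[ℚ] Qbar, ∀ x, τ (φ x) = ψ x :=
    exists_lift φ ψ
  refine ⟨AlgEquiv.ofBijective τ (Algebra.IsAlgebraic.algHom_bijective τ), ?_⟩
  exact AlgHom.ext hτ

theorem conj_comm (E : Type*) [Field E] [NumberField E]
    (F : IntermediateField ℚ E)
    (hFreal : ∀ ψ : ↥F →+* ℂ, ∀ x : ↥F, ∃ r : ℝ, ψ x = (r : ℂ))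
    (hEimag : ∀ ψ : E →+* ℂ, ∃ x : E, ∀ r : ℝ, ψ x ≠ (r : ℂ))
    (hEF : Module.finrank ↥F E = 2)
    (g : Qbar ≃ₐ[ℚ] Qbar) (φ : E →ₐ[ℚ] Qbar) :
    qbarConj.comp (g • φ) = g • (qbarConj.comp φ) := by
  have hF : ∀ (ψ : E →ₐ[ℚ] Qbar) (x : F), qbarConj (ψ x) = ψ x := by
    intro ψ x
    obtain ⟨r, hr⟩ := hFreal (((Qbar.val.comp ψ).comp F.val).toRingHom) x
    have hr' : ((ψ x : Qbar) : ℂ) = r := hr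
    apply Subtype.ext
    change (starRingEnd ℂ) ((ψ x : Qbar) : ℂ) = _
    rw [hr', Complex.conj_ofReal]
  have hE : ∀ (ψ : E →ₐ[ℚ] Qbar), qbarConj.comp ψ ≠ ψ := by
    intro ψ h
    obtain ⟨x, hx⟩ := hEimag ((Qbar.val.comp ψ).toRingHom)
    have h2 : (starRingEnd ℂ) ((ψ x : Qbar) : ℂ) = ψ x :=
      congrArg Subtype.val (DFunLike.congr_fun h x)
    obtain ⟨r, hr⟩ := Complex.conj_eq_iff_real.1 h2
    exact hx r hr
  haveI hac : IsAlgClosed Qbar := qbar_closed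
  letI : Algebra F Qbar := ((g • φ).comp F.val).toRingHom.toAlgebra
  have hcard : Fintype.card (E →ₐ[F] Qbar) = 2 := by
    rw [AlgHom.card, hEF]
  let a : E →ₐ[F] Qbar := { (g • φ).toRingHom with commutes' := fun x => rfl }
  let b : E →ₐ[F] Qbar :=
    { (qbarConj.comp (g • φ)).toRingHom with commutes' := fun x => hF (g • φ) x }
  let c : E →ₐ[F] Qbar :=
    { (g • (qbarConj.comp φ)).toRingHom with commutes' := fun x => congrArg g (hF φ x) }
  have hab : b ≠ a := fun h => hE (g • φ) (AlgHom.ext fun x => DFunLike.congr_fun h x)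
  have hac : c ≠ a := fun h => hE φ (AlgHom.ext fun x => g.injective (DFunLike.congr_fun h x))
  have hbc : b = c := by
    by_contra hbc
    classical
    have := Finset.card_le_univ ({a, b, c} : Finset (E →ₐ[F] Qbar))
    rw [hcard, Finset.card_eq_three.2 ⟨a, b, c, hab.symm, hac.symm, hbc, rfl⟩] at this
    omega
  exact AlgHom.ext fun x => DFunLike.congr_fun hbc x

set_option synthInstance.maxHeartbeats 1000000 in
/-- **The averaged reflex counting identity** `A⁰_{(E^♯,Φ^♯)} = (1/2d) Σ_Φ A⁰_{(E,Φ)}`: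
for a CM field `E` of degree `2d` with fixed embedding `ι₀ : E → ℚ̄`, the function `A⁰`
of the total reflex type `Φ^♯ = {CM types of E containing ι₀}` (computed for the
`G_ℚ`-set of CM types of `E`) is `1/(2d)` times the sum over all CM types `Φ` of `E`
of the functions `A⁰_Φ` (computed for the `G_ℚ`-set of embeddings `E → ℚ̄`). -/
theorem total_reflex_type_average
    (E : Type*) [Field E] [NumberField E]
    (d : ℕ) (hd : Module.finrank ℚ E = 2 * d)
    (F : IntermediateField ℚ E)
    (hFreal : ∀ ψ : ↥F →+* ℂ, ∀ x : ↥F, ∃ r : ℝ, ψ x = (r : ℂ))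
    (hEimag : ∀ ψ : E →+* ℂ, ∃ x : E, ∀ r : ℝ, ψ x ≠ (r : ℂ))
    (hEF : Module.finrank ↥F E = 2)
    (ι₀ : E →ₐ[ℚ] Qbar)
    (g : Qbar ≃ₐ[ℚ] Qbar) :
    A0 {Φ : Set (E →ₐ[ℚ] Qbar) | IsCMType E Φ ∧ ι₀ ∈ Φ} g =
      (1 / (2 * d) : ℚ) *
        ∑ Φ ∈ (Set.toFinite {Φ : Set (E →ₐ[ℚ] Qbar) | IsCMType E Φ}).toFinset,
          A0 Φ g := by
  haveI := pretrans_emb E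
  have hstab : ∀ (h : Qbar ≃ₐ[ℚ] Qbar),
      ∀ Φ ∈ {Φ : Set (E →ₐ[ℚ] Qbar) | IsCMType E Φ}, h • Φ ∈ {Φ | IsCMType E Φ} := by
    intro h Φ hΦ φ
    rw [Set.mem_smul_set_iff_inv_smul_mem, Set.mem_smul_set_iff_inv_smul_mem,
      ← conj_comm E F hFreal hEimag hEF]
    exact hΦ _
  haveI hac : IsAlgClosed Qbar := qbar_closed
  have hc : (Nat.card (E →ₐ[ℚ] Qbar) : ℚ) = 2 * d := by
    rw [Nat.card_eq_fintype_card, AlgHom.card, hd]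
    push_cast
    rfl
  have := abstract_avg {Φ : Set (E →ₐ[ℚ] Qbar) | IsCMType E Φ} hstab ι₀ g
  rw [hc] at this
  rw [one_div]
  exact this
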